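/- arXiv:0908.1241 — 3 statements merged into one kernel-verified Lean document; each statement's English description precedes it below -/
import Mathlib

section
/- Let T be the 4×4 real matrix T = M₁ M₂ M₃ M₄, where (in coordinates (y, x, p_y, p_x)) M₁ = [[1,0,δ−τ,0],[0,1,0,δ−τ],[0,0,1,0],[0,0,0,1]], M₂ = [[1,0,0,0],[0,1,0,0],[τ−δ,0,1,0],[0,0,0,1]], M₃ = [[1,0,τ,0],[0,1,0,τ],[0,0,1,0],[0,0,0,1]], M₄ = [[1,0,0,0],[0,1,0,0],[−τ(ω²+1),τω²,1,0],[τω²,−τω²,0,1]]. Then the characteristic polynomial of T is λ⁴ + c λ³ + b λ² + c λ + 1, where c = −4 + δ² − δ²τ² + 2δτ³ − τ⁴ + 2δτω² − δ²τ²ω² + 2δτ³ω² − τ⁴ω² and b = 6 − 2δ² + 2δ²τ² − 4δτ³ + 2τ⁴ − 4δτω² + δ³τω² + 2δ²τ²ω² − 4δτ³ω² − δ³τ³ω² + 2τ⁴ω² + 2δ²τ⁴ω² − δτ⁵ω². -/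
open Polynomial

/-- **Transfer-matrix characteristic polynomial for nonintrusive FLAVOR**
(from the proof of Theorem 5.1 of Tao–Owhadi–Marsden).  The one-step transfer matrix
`T = M₁ M₂ M₃ M₄` of the nonintrusive FLAVOR (built from Symplectic Euler) applied to the
linear Hamiltonian system `H = ½p_x² + ½p_y² + ½x² + (ω²/2)(y − x)²`, acting on the state
vector `(y, x, p_y, p_x)`, has characteristic polynomial
`λ⁴ + c λ³ + b λ² + c λ + 1` with the stated coefficients `b`, `c`. -/
theorem flavor_nonintrusive_transfer_charpoly (δ τ ω : ℝ) :
    (( !![1, 0, δ - τ, 0; 0, 1, 0, δ - τ; 0, 0, 1, 0; 0, 0, 0, 1] *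
       !![1, 0, 0, 0; 0, 1, 0, 0; τ - δ, 0, 1, 0; 0, 0, 0, 1] *
       !![1, 0, τ, 0; 0, 1, 0, τ; 0, 0, 1, 0; 0, 0, 0, 1] *
       !![1, 0, 0, 0; 0, 1, 0, 0; -τ * (ω ^ 2 + 1), τ * ω ^ 2, 1, 0;
          τ * ω ^ 2, -τ * ω ^ 2, 0, 1] : Matrix (Fin 4) (Fin 4) ℝ)).charpoly
      = X ^ 4
        + C (-4 + δ ^ 2 - δ ^ 2 * τ ^ 2 + 2 * δ * τ ^ 3 - τ ^ 4 + 2 * δ * τ * ω ^ 2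
              - δ ^ 2 * τ ^ 2 * ω ^ 2 + 2 * δ * τ ^ 3 * ω ^ 2 - τ ^ 4 * ω ^ 2) * X ^ 3
        + C (6 - 2 * δ ^ 2 + 2 * δ ^ 2 * τ ^ 2 - 4 * δ * τ ^ 3 + 2 * τ ^ 4
              - 4 * δ * τ * ω ^ 2 + δ ^ 3 * τ * ω ^ 2 + 2 * δ ^ 2 * τ ^ 2 * ω ^ 2
              - 4 * δ * τ ^ 3 * ω ^ 2 - δ ^ 3 * τ ^ 3 * ω ^ 2 + 2 * τ ^ 4 * ω ^ 2
              + 2 * δ ^ 2 * τ ^ 4 * ω ^ 2 - δ * τ ^ 5 * ω ^ 2) * X ^ 2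
        + C (-4 + δ ^ 2 - δ ^ 2 * τ ^ 2 + 2 * δ * τ ^ 3 - τ ^ 4 + 2 * δ * τ * ω ^ 2
              - δ ^ 2 * τ ^ 2 * ω ^ 2 + 2 * δ * τ ^ 3 * ω ^ 2 - τ ^ 4 * ω ^ 2) * X
        + 1 := by
  have hC (n : ℕ) [n.AtLeastTwo] : (C (OfNat.ofNat n) : ℝ[X]) = OfNat.ofNat n := map_ofNat C n
  simp only [Matrix.charpoly, Matrix.charmatrix, Matrix.det_succ_row_zero, Fin.sum_univ_succ]
  simp [Fin.succAbove, hC]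
  ring
end

section
/- Let T be the 4×4 real matrix T = N₁ N₂ N₃ N₄, where (in coordinates (y, x, p_y, p_x)) N₁ = [[1,0,(δ−τ)/2,(δ−τ)/2],[0,1,(δ−τ)/2,(δ−τ)/2],[0,0,1,0],[0,0,0,1]], N₂ = [[1,0,0,0],[0,1,0,0],[−τω²,τω²,1,0],[τω²,−τω²,0,1]], N₃ = [[1,0,τ,0],[0,1,0,τ],[0,0,1,0],[0,0,0,1]], N₄ = [[1,0,0,0],[0,1,0,0],[−δ,0,1,0],[0,0,0,1]]. Then the characteristic polynomial of T equals ½ [ 2λ⁴ + (4ω²τ² + τδ + δ² − 8)λ³ + (12 − 2δ² − 2δτ − 8τ²ω² + 2δ²τ²ω²)λ² + (4ω²τ² + τδ + δ² − 8)λ + 2 ]. -/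
open Polynomial

/-- **Transfer-matrix characteristic polynomial for artificial FLAVOR**
(from the proof of Theorem 5.1 of Tao–Owhadi–Marsden).  The one-step transfer matrix
`T = N₁ N₂ N₃ N₄` of the artificial FLAVOR (Symplectic-Euler fast step combined with
frozen-fast-variable translation) applied to the linear Hamiltonian system
`H = ½p_x² + ½p_y² + ½x² + (ω²/2)(y − x)²`, acting on the state vector `(y, x, p_y, p_x)`,
has characteristic polynomial
`½ [2λ⁴ + (4ω²τ² + τδ + δ² − 8)λ³ + (12 − 2δ² − 2δτ − 8τ²ω² + 2δ²τ²ω²)λ²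
    + (4ω²τ² + τδ + δ² − 8)λ + 2]`. -/
theorem flavor_artificial_transfer_charpoly (δ τ ω : ℝ) :
    (( !![1, 0, (δ - τ) / 2, (δ - τ) / 2; 0, 1, (δ - τ) / 2, (δ - τ) / 2;
          0, 0, 1, 0; 0, 0, 0, 1] *
       !![1, 0, 0, 0; 0, 1, 0, 0; -τ * ω ^ 2, τ * ω ^ 2, 1, 0;
          τ * ω ^ 2, -τ * ω ^ 2, 0, 1] *
       !![1, 0, τ, 0; 0, 1, 0, τ; 0, 0, 1, 0; 0, 0, 0, 1] *
       !![1, 0, 0, 0; 0, 1, 0, 0; -δ, 0, 1, 0; 0, 0, 0, 1] :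
          Matrix (Fin 4) (Fin 4) ℝ)).charpoly
      = C (1 / 2 : ℝ) *
          (2 * X ^ 4
            + C (4 * ω ^ 2 * τ ^ 2 + τ * δ + δ ^ 2 - 8) * X ^ 3
            + C (12 - 2 * δ ^ 2 - 2 * δ * τ - 8 * τ ^ 2 * ω ^ 2
                  + 2 * δ ^ 2 * τ ^ 2 * ω ^ 2) * X ^ 2
            + C (4 * ω ^ 2 * τ ^ 2 + τ * δ + δ ^ 2 - 8) * X
            + 2) := by
  refine Polynomial.funext fun r => ?_
  rw [Matrix.eval_charpoly]
  simp [Matrix.det_succ_row_zero, Fin.sum_univ_succ, Fin.succAbove, Matrix.scalar_apply,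
    Matrix.diagonal_apply]
  ring
end

section
/- Let V, U : ℝ^d → ℝ be differentiable, ε > 0, and 0 < τ < δ. Define the FLAVORized discrete Lagrangian L_d(q_k, q'_k, q_{k+1}) := τ[ ½|(q'_k − q_k)/τ|² − (V(q_k) + (1/ε)U(q_k)) ] + (δ − τ)[ ½|(q_{k+1} − q'_k)/(δ − τ)|² − V(q'_k) ]. Then a sequence (q_k, q'_k) is a critical point of the discrete action Σ_k L_d(q_k, q'_k, q_{k+1}) (i.e., it satisfies the discrete Euler–Lagrange equations obtained by setting to zero the partial derivatives of the action with respect to each interior point q'_k and q_k) if and only if, defining p'_k := (q'_k − q_k)/τ and p_{k+1} := (q_{k+1} − q'_k)/(δ − τ), the sequence satisfies the FLAVORized Variational Euler scheme: p'_k = p_k − τ[∇V(q_k) + (1/ε)∇U(q_k)], q'_k = q_k + τ p'_k, p_{k+1} = p'_k − (δ − τ)∇V(q'_k), q_{k+1} = q'_k + (δ − τ) p_{k+1}. -/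
section

variable {E : Type*} [NormedAddCommGroup E] [InnerProductSpace ℝ E]

/-- The derivative along a line of a function with a gradient. -/
lemma HasGradientAt.hasDerivAt_line [CompleteSpace E] {f : E → ℝ} {g x : E}
    (hf : HasGradientAt f g x) (v : E) :
    HasDerivAt (fun s : ℝ => f (x + s • v)) (inner ℝ g v) 0 := by
  have hline : HasDerivAt (fun s : ℝ => x + s • v) v 0 := by
    simpa using ((hasDerivAt_id (0 : ℝ)).smul_const v).const_add x
  have hf' : HasFDerivAt f (InnerProductSpace.toDual ℝ E g) (x + (0 : ℝ) • v) := by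
    simpa using hf.hasFDerivAt
  have hcomp := hf'.comp_hasDerivAt (0 : ℝ) hline
  rw [InnerProductSpace.toDual_apply_apply] at hcomp
  exact hcomp

/-- The derivative along a line of the discrete kinetic energy in its endpoint. -/
lemma hasDerivAt_discreteKinetic {h : ℝ} (hh : h ≠ 0) (a x v : E) :
    HasDerivAt (fun s : ℝ => h * ((1 / 2) * ‖(1 / h) • (x + s • v - a)‖ ^ 2))
      (inner ℝ ((1 / h) • (x - a)) v) 0 := by
  have hline : HasDerivAt (fun s : ℝ => (1 / h) • (x + s • v - a)) ((1 / h) • v) 0 := by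
    have hpath : HasDerivAt (fun s : ℝ => x + s • v - a) v 0 := by
      simpa using (((hasDerivAt_id (0 : ℝ)).smul_const v).const_add x).sub_const a
    exact hpath.const_smul (1 / h)
  refine ((hline.norm_sq.const_mul (1 / 2 : ℝ)).const_mul h).congr_deriv ?_
  simp only [zero_smul, add_zero, real_inner_smul_left, real_inner_smul_right]
  field_simp

/-- If the derivatives of `f v` at `0` are the pairings with `g`, they all vanish iff `g = 0`. -/
lemma forall_hasDerivAt_zero_iff {f : E → ℝ → ℝ} {g : E}
    (hf : ∀ v, HasDerivAt (f v) (inner ℝ g v) 0) :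
    (∀ v, HasDerivAt (f v) 0 0) ↔ g = 0 := by
  refine ⟨fun h => ?_, fun h v => by simpa [h] using hf v⟩
  exact inner_self_eq_zero.mp ((hf g).unique (h g))

end


/-- **Variational derivation of FLAVOR** (Section 2.2 of Tao–Owhadi–Marsden).
Let `V, U : ℝ^d → ℝ` be differentiable (with gradients `gV`, `gU`), `ε > 0`, `0 < τ < δ`,
and let `L_d(q_k, q'_k, q_{k+1})` be the FLAVORized discrete Lagrangian
`τ[½|(q'_k − q_k)/τ|² − (V(q_k) + ε⁻¹U(q_k))] + (δ−τ)[½|(q_{k+1} − q'_k)/(δ−τ)|² − V(q'_k)]`.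
A sequence `(q_k, q'_k)` is a critical point of the discrete action
`Σ_k L_d(q_k, q'_k, q_{k+1})` — i.e. all directional derivatives of the action with respect
to each interior point `q'_k` and `q_k` vanish — if and only if, with
`p'_k := (q'_k − q_k)/τ` and `p_{k+1} := (q_{k+1} − q'_k)/(δ−τ)`, it satisfies the
FLAVORized Variational Euler scheme. -/
theorem flavor_discrete_variational_principle
    (d : ℕ)
    (V U : EuclideanSpace ℝ (Fin d) → ℝ)
    (gV gU : EuclideanSpace ℝ (Fin d) → EuclideanSpace ℝ (Fin d))
    (hV : ∀ x, HasGradientAt V (gV x) x)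
    (hU : ∀ x, HasGradientAt U (gU x) x)
    (ε δ τ : ℝ) (hε : 0 < ε) (hτ : 0 < τ) (hτδ : τ < δ)
    (Ld : EuclideanSpace ℝ (Fin d) → EuclideanSpace ℝ (Fin d) →
          EuclideanSpace ℝ (Fin d) → ℝ)
    (hLd : ∀ a b c, Ld a b c =
      τ * ((1 / 2) * ‖(1 / τ) • (b - a)‖ ^ 2 - (V a + ε⁻¹ * U a)) +
      (δ - τ) * ((1 / 2) * ‖(1 / (δ - τ)) • (c - b)‖ ^ 2 - V b))
    (q q' : ℕ → EuclideanSpace ℝ (Fin d))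
    (p' : ℕ → EuclideanSpace ℝ (Fin d))
    (hp' : ∀ k, p' k = (1 / τ) • (q' k - q k))
    (p : ℕ → EuclideanSpace ℝ (Fin d))
    (hp : ∀ k, p (k + 1) = (1 / (δ - τ)) • (q (k + 1) - q' k)) :
    ( (∀ (k : ℕ) (v : EuclideanSpace ℝ (Fin d)),
        HasDerivAt (fun s : ℝ => Ld (q k) (q' k + s • v) (q (k + 1))) 0 0) ∧
      (∀ (k : ℕ) (v : EuclideanSpace ℝ (Fin d)),
        HasDerivAt (fun s : ℝ =>
          Ld (q k) (q' k) (q (k + 1) + s • v) +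
          Ld (q (k + 1) + s • v) (q' (k + 1)) (q (k + 2))) 0 0) )
    ↔
    ( (∀ k : ℕ, p' (k + 1) = p (k + 1) - τ • (gV (q (k + 1)) + ε⁻¹ • gU (q (k + 1)))) ∧
      (∀ k : ℕ, q' k = q k + τ • p' k) ∧
      (∀ k : ℕ, p (k + 1) = p' k - (δ - τ) • gV (q' k)) ∧
      (∀ k : ℕ, q (k + 1) = q' k + (δ - τ) • p (k + 1)) ) := by
  have hτ0 : τ ≠ 0 := hτ.ne'
  have hδτ : δ - τ ≠ 0 := (sub_pos.mpr hτδ).ne'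
  have hmid : ∀ k, (∀ v, HasDerivAt (fun s : ℝ => Ld (q k) (q' k + s • v) (q (k + 1))) 0 0) ↔
      p' k - p (k + 1) - (δ - τ) • gV (q' k) = 0 := by
    refine fun k => forall_hasDerivAt_zero_iff fun v => ?_
    have hsum := ((hasDerivAt_discreteKinetic hτ0 (q k) (q' k) v).add
      (hasDerivAt_discreteKinetic hδτ (q (k + 1)) (q' k) v)).sub
      (((hV (q' k)).hasDerivAt_line v).const_mul (δ - τ)) |>.sub_const
      (τ * (V (q k) + ε⁻¹ * U (q k)))
    refine (hsum.congr_deriv ?_).congr_of_eventuallyEq (.of_forall fun s => ?_)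
    · rw [hp', hp, ← neg_sub (q' k) (q (k + 1))]
      simp only [inner_sub_left, inner_neg_left, smul_neg, real_inner_smul_left]
      ring
    · simp only [hLd, Pi.add_apply, Pi.sub_apply, norm_smul, norm_sub_rev (q (k + 1))]
      ring
  have hend : ∀ k, (∀ v, HasDerivAt (fun s : ℝ => Ld (q k) (q' k) (q (k + 1) + s • v) +
        Ld (q (k + 1) + s • v) (q' (k + 1)) (q (k + 2))) 0 0) ↔
      p (k + 1) - p' (k + 1) - τ • (gV (q (k + 1)) + ε⁻¹ • gU (q (k + 1))) = 0 := by
    refine fun k => forall_hasDerivAt_zero_iff fun v => ?_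
    have hsum := ((hasDerivAt_discreteKinetic hδτ (q' k) (q (k + 1)) v).add
      (hasDerivAt_discreteKinetic hτ0 (q' (k + 1)) (q (k + 1)) v)).sub
      ((((hV (q (k + 1))).hasDerivAt_line v).add
        (((hU (q (k + 1))).hasDerivAt_line v).const_mul ε⁻¹)).const_mul τ) |>.add_const
      (τ * ((1 / 2) * ‖(1 / τ) • (q' k - q k)‖ ^ 2 - (V (q k) + ε⁻¹ * U (q k)))
        - (δ - τ) * V (q' k) + (δ - τ) * ((1 / 2) *
          ‖(1 / (δ - τ)) • (q (k + 2) - q' (k + 1))‖ ^ 2 - V (q' (k + 1))))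
    refine (hsum.congr_deriv ?_).congr_of_eventuallyEq (.of_forall fun s => ?_)
    · rw [hp', hp, ← neg_sub (q (k + 1)) (q' (k + 1))]
      simp only [inner_sub_left, inner_add_left, inner_neg_left, smul_neg, real_inner_smul_left]
      ring
    · simp only [hLd, Pi.add_apply, Pi.sub_apply, norm_smul, norm_sub_rev (q' (k + 1))]
      ring
  have hq' : ∀ k, q' k = q k + τ • p' k := fun k => by
    rw [hp', smul_smul, mul_one_div_cancel hτ0, one_smul, add_sub_cancel]
  have hq : ∀ k, q (k + 1) = q' k + (δ - τ) • p (k + 1) := fun k => by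
    rw [hp, smul_smul, mul_one_div_cancel hδτ, one_smul, add_sub_cancel]
  simp only [hmid, hend]
  constructor
  · rintro ⟨hm, he⟩
    refine ⟨fun k => ?_, hq', fun k => ?_, hq⟩
    · rw [← sub_eq_zero, ← neg_eq_zero, ← he k]
      abel
    · rw [← sub_eq_zero, ← neg_eq_zero, ← hm k]
      abel
  · rintro ⟨he, -, hm, -⟩
    refine ⟨fun k => ?_, fun k => ?_⟩
    · rw [hm k]
      abel
    · rw [he k]
      abel
end
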